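/- Let S be a white noise stochastic flow on a Polish space X with Markov semigroup P_{st}f(x) := 𝔼[f(S(t,s;·)x)]. Let {μ_t}_{t∈ℝ} be an evolution system of measures for S such that for each t ∈ ℝ the disintegration ω ↦ μ_{tω} is 𝓕_{≤t}-measurable (i.e. ω ↦ μ_{tω}(B) is 𝓕_{≤t}-measurable for every Borel B ⊆ X). Then ρ_t(B) := ∫_Ω μ_{tω}(B) dℙ(ω), t ∈ ℝ, B ∈ 𝓑(X), defines an evolution system of measures for {P_{st}}, i.e. P_{st}ρ_s = ρ_t for all s ≤ t. -/

import Mathlib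

open MeasureTheory Filter Topology

/-- A stochastic flow on a metric space `X` over a probability space `(Ω, 𝓕, ℙ)`:
a family of maps `S t s ω : X → X` (for `s ≤ t`) satisfying, for `ℙ`-a.e. `ω`,
the cocycle property, continuity in `x`, the identity at equal times, and a joint
measurability condition in `(s, ω)` on `(-∞, t] × Ω`. -/
def IsStochasticFlow {Ω X : Type*} [MeasurableSpace Ω] [MetricSpace X]
    [MeasurableSpace X] [BorelSpace X]
    (ℙ : Measure Ω) (S : ℝ → ℝ → Ω → X → X) : Prop :=
  (∀ᵐ ω ∂ℙ,
    (∀ s r t : ℝ, s ≤ r → r ≤ t → ∀ x : X, S t r ω (S r s ω x) = S t s ω x) ∧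
    (∀ s t : ℝ, s ≤ t → Continuous fun x : X => S t s ω x) ∧
    (∀ t : ℝ, ∀ x : X, S t t ω x = x)) ∧
  (∀ t : ℝ, ∀ x : X, Measurable fun p : {s : ℝ // s ≤ t} × Ω => S t p.1.1 p.2 x)

/-- `K` is an attracting set at time `t` for the sample point `ω`: every nonempty
bounded set `B` satisfies `d(S(t,s;ω)B, K) → 0` as `s → -∞`, where
`d(A,B) = sup_{x ∈ A} inf_{y ∈ B} d(x,y)` (formulated with `EMetric.infEdist`). -/
def Attracts {Ω X : Type*} [MetricSpace X]
    (S : ℝ → ℝ → Ω → X → X) (t : ℝ) (ω : Ω) (K : Set X) : Prop :=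
  ∀ B : Set X, B.Nonempty → Bornology.IsBounded B →
    Tendsto (fun s : ℝ => ⨆ x ∈ B, EMetric.infEdist (S t s ω x) K) atBot (𝓝 0)

/-- The stochastic flow `S` is asymptotically compact with compact attracting sets `K t ω`
on a full-measure set `Ω₀`. -/
def IsAsymptoticallyCompact {Ω X : Type*} [MeasurableSpace Ω] [MetricSpace X]
    (ℙ : Measure Ω) (S : ℝ → ℝ → Ω → X → X) : Prop :=
  ∃ Ω₀ : Set Ω, MeasurableSet Ω₀ ∧ ℙ Ω₀ = 1 ∧
    ∀ ω ∈ Ω₀, ∀ t : ℝ, ∃ K : Set X, IsCompact K ∧ Attracts S t ω K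

/-- An evolution system of measures for the stochastic flow `S`: a family of probability
measures `μ t` on `Ω × X` with marginal `ℙ` on `Ω`, such that the image of `μ s` under
`(ω, x) ↦ (ω, S t s ω x)` is `μ t` whenever `s ≤ t`. -/
def IsEvolutionSystem {Ω X : Type*} [MeasurableSpace Ω] [MeasurableSpace X]
    (ℙ : Measure Ω) (S : ℝ → ℝ → Ω → X → X) (μ : ℝ → Measure (Ω × X)) : Prop :=
  (∀ t : ℝ, IsProbabilityMeasure (μ t)) ∧
  (∀ t : ℝ, (μ t).map Prod.fst = ℙ) ∧
  (∀ s t : ℝ, s ≤ t → (μ s).map (fun p : Ω × X => (p.1, S t s p.1 p.2)) = μ t)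

/-- The `ℙ`-completion of a sub-σ-algebra `m`: generated by all sets differing from an
`m`-measurable set by a `ℙ`-null set. -/
def completionOf {Ω : Type*} [MeasurableSpace Ω] (ℙ : Measure Ω)
    (m : MeasurableSpace Ω) : MeasurableSpace Ω :=
  MeasurableSpace.generateFrom {A | ∃ B : Set Ω, MeasurableSet[m] B ∧ ℙ (symmDiff A B) = 0}

/-- The σ-algebra generated by the random variables `ω ↦ S u t ω x` with `s ≤ t ≤ u`. -/
def sigmaGe {Ω X : Type*} [MeasurableSpace X] (S : ℝ → ℝ → Ω → X → X) (s : ℝ) :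
    MeasurableSpace Ω :=
  MeasurableSpace.generateFrom
    {A | ∃ (t u : ℝ) (x : X) (B : Set X), s ≤ t ∧ t ≤ u ∧ MeasurableSet B ∧
      A = {ω | S u t ω x ∈ B}}

/-- The σ-algebra generated by the random variables `ω ↦ S u t ω x` with `t ≤ u ≤ s`. -/
def sigmaLe {Ω X : Type*} [MeasurableSpace X] (S : ℝ → ℝ → Ω → X → X) (s : ℝ) :
    MeasurableSpace Ω :=
  MeasurableSpace.generateFrom
    {A | ∃ (t u : ℝ) (x : X) (B : Set X), t ≤ u ∧ u ≤ s ∧ MeasurableSet B ∧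
      A = {ω | S u t ω x ∈ B}}

/-- `𝓕_{≥ s}`: the `ℙ`-completion of the σ-algebra generated by the flow after time `s`. -/
def Fge {Ω X : Type*} [MeasurableSpace Ω] [MeasurableSpace X]
    (ℙ : Measure Ω) (S : ℝ → ℝ → Ω → X → X) (s : ℝ) : MeasurableSpace Ω :=
  completionOf ℙ (sigmaGe S s)

/-- `𝓕_{≤ s}`: the `ℙ`-completion of the σ-algebra generated by the flow before time `s`. -/
def Fle {Ω X : Type*} [MeasurableSpace Ω] [MeasurableSpace X]
    (ℙ : Measure Ω) (S : ℝ → ℝ → Ω → X → X) (s : ℝ) : MeasurableSpace Ω :=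
  completionOf ℙ (sigmaLe S s)

/-- A white noise stochastic flow: a stochastic flow such that for every `s ∈ ℝ`, the
σ-algebras `𝓕_{≥ s}` and `𝓕_{≤ s}` are independent. -/
def IsWhiteNoiseFlow {Ω X : Type*} [MeasurableSpace Ω] [MetricSpace X]
    [MeasurableSpace X] [BorelSpace X]
    (ℙ : Measure Ω) (S : ℝ → ℝ → Ω → X → X) : Prop :=
  IsStochasticFlow ℙ S ∧
  ∀ s : ℝ, ProbabilityTheory.Indep (Fge ℙ S s) (Fle ℙ S s) ℙ

/-- An evolution system of measures for the Markov transition semigroup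
`P_{st} f x = 𝔼[f (S t s · x)]` associated to the flow `S`: a family of Borel
probability measures `ρ s` on `X` with `P_{st} ρ_s = ρ_t` for all `s ≤ t`. -/
def IsMarkovEvolutionSystem {Ω X : Type*} [MeasurableSpace Ω] [MeasurableSpace X]
    (ℙ : Measure Ω) (S : ℝ → ℝ → Ω → X → X) (ρ : ℝ → Measure X) : Prop :=
  (∀ t : ℝ, IsProbabilityMeasure (ρ t)) ∧
  (∀ s t : ℝ, s ≤ t → ∀ B : Set X, MeasurableSet B →
    (∫⁻ x, ℙ {ω | S t s ω x ∈ B} ∂(ρ s)) = ρ t B)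

lemma measure_preimage_prodMap_eq_lintegral {Ω Ω' X : Type*} [MeasurableSpace Ω]
    [MeasurableSpace Ω'] [MeasurableSpace X] {ℙ : Measure Ω} [IsProbabilityMeasure ℙ]
    {π : Ω → Ω'} (hπ : Measurable π) {μ : Measure (Ω × X)} {ρ : Measure X}
    [IsProbabilityMeasure ρ]
    (h : ∀ (F : Set Ω') (B : Set X), MeasurableSet F → MeasurableSet B →
      μ ((π ⁻¹' F) ×ˢ B) = ℙ (π ⁻¹' F) * ρ B)
    {C : Set (Ω' × X)} (hC : MeasurableSet C) :
    μ (Prod.map π id ⁻¹' C) = ∫⁻ x, ℙ {ω | (π ω, x) ∈ C} ∂ρ := by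
  have : IsProbabilityMeasure (ℙ.map π) := Measure.isProbabilityMeasure_map hπ.aemeasurable
  have hm : Measurable (Prod.map π (id : X → X)) := hπ.prodMap measurable_id
  have key : (ℙ.map π).prod ρ = μ.map (Prod.map π id) := by
    refine Measure.prod_eq fun F B hF hB => ?_
    rw [Measure.map_apply hm (hF.prod hB), Measure.map_apply hπ hF, ← h F B hF hB]
    rfl
  rw [← Measure.map_apply hm hC, ← key, Measure.prod_apply_symm hC]
  refine lintegral_congr fun x => ?_
  rw [Measure.map_apply hπ (measurable_prodMk_right hC)]
  rfl

lemma measure_preimage_eq_lintegral_of_le {Ω X Y : Type*} {m : MeasurableSpace Ω}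
    [m₀ : MeasurableSpace Ω] [MeasurableSpace X] [MeasurableSpace Y] (hm : m ≤ m₀)
    {ℙ : Measure Ω} [IsProbabilityMeasure ℙ] {μ : Measure (Ω × X)} {ρ : Measure X}
    [IsProbabilityMeasure ρ]
    (h : ∀ (F : Set Ω) (A : Set X), MeasurableSet[m] F → MeasurableSet A →
      μ (F ×ˢ A) = ℙ F * ρ A)
    {f : Ω × X → Y} (hf : @Measurable (Ω × X) Y (m.prod inferInstance) _ f)
    {B : Set Y} (hB : MeasurableSet B) :
    μ (f ⁻¹' B) = ∫⁻ x, ℙ {ω | f (ω, x) ∈ B} ∂ρ :=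
  @measure_preimage_prodMap_eq_lintegral Ω Ω X m₀ m _ ℙ _ id (measurable_id'' hm) μ ρ _ h
    (f ⁻¹' B) (hf hB)

lemma measurableSet_completionOf_of_ae_eq {Ω : Type*} {m : MeasurableSpace Ω}
    [MeasurableSpace Ω] {ℙ : Measure Ω} {A B : Set Ω} (hB : MeasurableSet[m] B) (h : A =ᵐ[ℙ] B) :
    MeasurableSet[completionOf ℙ m] A :=
  MeasurableSpace.measurableSet_generateFrom ⟨B, hB, measure_symmDiff_eq_zero_iff.2 h⟩

lemma completionOf_le_nullMeasurableSpace {Ω : Type*} {m : MeasurableSpace Ω}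
    [m₀ : MeasurableSpace Ω] {ℙ : Measure Ω} (hm : m ≤ m₀) {A : Set Ω} (hA : MeasurableSet[completionOf ℙ m] A) :
    NullMeasurableSet A ℙ := by
  refine MeasurableSpace.generateFrom_le
    (m := (inferInstance : MeasurableSpace (NullMeasurableSpace Ω ℙ))) ?_ A hA
  rintro A ⟨B, hB, h⟩
  exact (hm B hB).nullMeasurableSet.congr (measure_symmDiff_eq_zero_iff.1 h).symm

section StochasticFlow

variable {Ω X : Type*} [m₀ : MeasurableSpace Ω] [MetricSpace X] [MeasurableSpace X] [BorelSpace X]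
  {ℙ : Measure Ω} {S : ℝ → ℝ → Ω → X → X}

lemma IsStochasticFlow.measurable_apply (hS : IsStochasticFlow ℙ S) {s t : ℝ} (hst : s ≤ t)
    (x : X) : Measurable fun ω => S t s ω x :=
  (hS.2 t x).comp (measurable_prodMk_left (x := (⟨s, hst⟩ : {s : ℝ // s ≤ t})))

lemma IsStochasticFlow.sigmaLe_le (hS : IsStochasticFlow ℙ S) (s : ℝ) : sigmaLe S s ≤ m₀ := by
  refine MeasurableSpace.generateFrom_le ?_
  rintro A ⟨t, u, x, B, htu, -, hB, rfl⟩
  exact hS.measurable_apply htu x hB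

lemma IsStochasticFlow.aemeasurable_of_measurable_Fle (hS : IsStochasticFlow ℙ S) {s : ℝ}
    {f : Ω → ENNReal} (hf : Measurable[Fle ℙ S s] f) : AEMeasurable f ℙ :=
  NullMeasurable.aemeasurable fun _ hB =>
    completionOf_le_nullMeasurableSpace (hS.sigmaLe_le s) (hf hB)

lemma IsWhiteNoiseFlow.setLIntegral_eq_mul (hS : IsWhiteNoiseFlow ℙ S) {s : ℝ} {F : Set Ω}
    (hF : MeasurableSet F) (hF' : MeasurableSet[Fge ℙ S s] F) {f : Ω → ENNReal}
    (hf : Measurable[Fle ℙ S s] f) : ∫⁻ ω in F, f ω ∂ℙ = ℙ F * ∫⁻ ω, f ω ∂ℙ := by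
  have hind : ProbabilityTheory.IndepFun (F.indicator (1 : Ω → ENNReal)) f ℙ := by
    rw [ProbabilityTheory.IndepFun_iff_Indep]
    refine ProbabilityTheory.indep_of_indep_of_le_left (ProbabilityTheory.indep_of_indep_of_le_right (hS.2 s) hf.comap_le) ?_
    have h1 : Measurable[Fge ℙ S s] (1 : Ω → ENNReal) := @measurable_const _ _ _ (Fge ℙ S s) 1
    exact (h1.indicator hF').comap_le
  have h := ProbabilityTheory.lintegral_mul_eq_lintegral_mul_lintegral_of_indepFun''
    (measurable_one.indicator hF).aemeasurable (hS.1.aemeasurable_of_measurable_Fle hf) hind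
  rw [lintegral_indicator_one hF] at h
  rw [← h, ← lintegral_indicator hF]
  refine lintegral_congr fun ω => ?_
  by_cases hω : ω ∈ F <;> simp [hω]

/-- Up to a null set, the time-`s`-to-`t` map of a flow is jointly measurable in `(ω, x)`, with
respect to the measurable sets of `Fge ℙ S s`. -/
lemma IsStochasticFlow.exists_measurable_modification [TopologicalSpace.SeparableSpace X]
    (hS : IsStochasticFlow ℙ S) {s t : ℝ} (hst : s ≤ t) :
    ∃ φ : Ω → X → X, (∀ᵐ ω ∂ℙ, ∀ x, φ ω x = S t s ω x) ∧
      @Measurable (Ω × X) X ((Fge ℙ S s ⊓ m₀).prod inferInstance) _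
        (fun p : Ω × X => φ p.1 p.2) := by
  classical
  obtain ⟨N, hN, hNm, hN0⟩ := exists_measurable_superset_of_null (ae_iff.1 hS.1)
  have hc : ∀ ω ∉ N, Continuous fun x => S t s ω x := fun ω hω =>
    (not_not.1 fun h => hω (hN h)).2.1 s t hst
  have hae : ∀ᵐ ω ∂ℙ, ω ∉ N := measure_eq_zero_iff_ae_notMem.1 hN0
  have hφ : ∀ᵐ ω ∂ℙ, ∀ x, (if ω ∈ N then x else S t s ω x) = S t s ω x := by
    filter_upwards [hae] with ω hω x
    simp [hω]
  refine ⟨fun ω x => if ω ∈ N then x else S t s ω x, hφ, ?_⟩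
  have := UniformSpace.secondCountable_of_separable X
  refine (@measurable_uncurry_of_continuous_of_measurable Ω X X _ _ _ _ _ _ _ _ _
    (Fge ℙ S s ⊓ m₀) (fun x ω => if ω ∈ N then x else S t s ω x) ?_ ?_).comp
    (@measurable_swap _ _ (Fge ℙ S s ⊓ m₀) _)
  · intro ω
    by_cases hω : ω ∈ N
    · simpa [hω] using continuous_id'
    · simpa [hω] using hc ω hω
  · intro x B hB
    refine MeasurableSpace.measurableSet_inf.2 ⟨?_, ?_⟩
    · refine measurableSet_completionOf_of_ae_eq (B := {ω | S t s ω x ∈ B}) ?_ ?_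
      · exact MeasurableSpace.measurableSet_generateFrom ⟨s, t, x, B, le_rfl, hst, hB, rfl⟩
      · filter_upwards [hφ] with ω hω
        exact congrArg (· ∈ B) (hω x)
    · exact Measurable.ite hNm measurable_const (hS.measurable_apply hst x) hB

end StochasticFlow

/-- if `{μ t}` is an evolution system of measures for the white noise
stochastic flow `S` whose disintegration `ω ↦ κ t ω` is `𝓕_{≤ t}`-measurable for each
`t`, then `ρ t B := ∫ κ t ω B dℙ(ω)` defines an evolution system of measures for the
Markov semigroup `{P_{st}}`. -/
theorem stmt12 {Ω X : Type*} [MeasurableSpace Ω] [MetricSpace X] [CompleteSpace X]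
    [TopologicalSpace.SeparableSpace X] [MeasurableSpace X] [BorelSpace X]
    (ℙ : Measure Ω) [IsProbabilityMeasure ℙ]
    (S : ℝ → ℝ → Ω → X → X) (hS : IsWhiteNoiseFlow ℙ S)
    (μ : ℝ → Measure (Ω × X)) (κ : ℝ → Ω → Measure X)
    (hμ : IsEvolutionSystem ℙ S μ)
    (hκprob : ∀ (t : ℝ) (ω : Ω), IsProbabilityMeasure (κ t ω))
    (hκmeas : ∀ (t : ℝ) (B : Set X), MeasurableSet B →
      Measurable[Fle ℙ S t] fun ω => κ t ω B)
    (hdis : ∀ (t : ℝ) (F : Set Ω) (B : Set X), MeasurableSet F → MeasurableSet B →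
      μ t (F ×ˢ B) = ∫⁻ ω in F, κ t ω B ∂ℙ)
    (ρ : ℝ → Measure X)
    (hρ : ∀ (t : ℝ) (B : Set X), MeasurableSet B → ρ t B = ∫⁻ ω, κ t ω B ∂ℙ) :
    IsMarkovEvolutionSystem ℙ S ρ := by
  have hρprob : ∀ t, IsProbabilityMeasure (ρ t) := fun t => ⟨by
    rw [hρ t _ MeasurableSet.univ]
    simp [(hκprob t _).measure_univ]⟩
  refine ⟨hρprob, fun s t hst B hB => ?_⟩
  obtain ⟨φ, hφS, hφ⟩ := hS.1.exists_measurable_modification hst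
  have hle : Fge ℙ S s ⊓ ‹MeasurableSpace Ω› ≤ ‹MeasurableSpace Ω› := inf_le_right
  have hφ' : Measurable fun p : Ω × X => φ p.1 p.2 :=
    hφ.mono (sup_le_sup_right (MeasurableSpace.comap_mono hle) _) le_rfl
  have key : μ s ((fun p : Ω × X => φ p.1 p.2) ⁻¹' B) =
      ∫⁻ x, ℙ {ω | φ ω x ∈ B} ∂ρ s := by
    refine measure_preimage_eq_lintegral_of_le hle (fun F A hF hA => ?_) hφ hB
    obtain ⟨hF', hF⟩ := MeasurableSpace.measurableSet_inf.1 hF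
    rw [hdis s F A hF hA, hρ s A hA, hS.setLIntegral_eq_mul hF hF' (hκmeas s A hA)]
  have hφμ : (fun p : Ω × X => (p.1, S t s p.1 p.2)) =ᵐ[μ s] fun p => (p.1, φ p.1 p.2) := by
    have : ∀ᵐ ω ∂(μ s).map Prod.fst, ∀ x, φ ω x = S t s ω x := by rwa [hμ.2.1 s]
    filter_upwards [ae_of_ae_map measurable_fst.aemeasurable this] with p hp
    rw [hp]
  have hρt : ρ t B = μ s ((fun p : Ω × X => φ p.1 p.2) ⁻¹' B) := by
    rw [hρ t B hB, ← setLIntegral_univ, ← hdis t _ B MeasurableSet.univ hB, ← hμ.2.2 s t hst,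
      Measure.map_congr hφμ, Measure.map_apply (measurable_fst.prodMk hφ')
        (MeasurableSet.univ.prod hB)]
    congr 1
    ext p
    simp
  rw [hρt]
  refine Eq.trans (lintegral_congr fun x => measure_congr ?_) key.symm
  filter_upwards [hφS] with ω hω
  exact congrArg (· ∈ B) (hω x).symm
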